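/- Let G be a K_{r,s}-subgraph-free graph (containing no subgraph isomorphic to the complete bipartite graph K_{r,s}). There is a number c(r,s,ℓ), depending only on r, s and ℓ, such that if G contains a path of length c(r,s,ℓ) (as a subgraph), then G contains an induced path on ℓ vertices. -/

import Mathlib

/-- `tdLE G n` : `G` admits an elimination-forest order whose chains have at most `n` vertices,
i.e. the treedepth of `G` is at most `n`. -/
def tdLE {V : Type*} (G : SimpleGraph V) (n : ℕ) : Prop :=
  ∃ le : V → V → Prop,
    (∀ v, le v v) ∧
    (∀ u v w, le u v → le v w → le u w) ∧
    (∀ u v, le u v → le v u → u = v) ∧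
    (∀ u v w, le u w → le v w → (le u v ∨ le v u)) ∧
    (∀ u v, G.Adj u v → (le u v ∨ le v u)) ∧
    (∀ s : Finset V, (∀ u ∈ s, ∀ v ∈ s, le u v ∨ le v u) → s.card ≤ n)

/-- The treedepth of a graph. -/
noncomputable def treedepth {V : Type*} (G : SimpleGraph V) : ℕ :=
  sInf {n | tdLE G n}

/-- `diamLE G d` : every two vertices of `G` are joined by a walk of length at most `d`. -/
def diamLE {V : Type*} (G : SimpleGraph V) (d : ℕ) : Prop :=
  ∀ u v : V, ∃ p : G.Walk u v, p.length ≤ d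

/-- `G` contains `H` as a subgraph. -/
def ContainsSub {V W : Type*} (G : SimpleGraph V) (H : SimpleGraph W) : Prop :=
  ∃ f : H →g G, Function.Injective f

/-- `G` contains `H` as an induced subgraph. -/
def ContainsInduced {V W : Type*} (G : SimpleGraph V) (H : SimpleGraph W) : Prop :=
  ∃ s : Set V, Nonempty ((G.induce s) ≃g H)

/-- Pigeonhole principle for a list of coloured elements. -/
theorem List.exists_le_length_filter_snd {α K : Type*} [Fintype K] [DecidableEq K] (n : ℕ)
    (T : List (α × K)) (hT : Fintype.card K * n < T.length) :
    ∃ κ, n ≤ (T.filter (fun p => p.2 = κ)).length := by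
  have key : ∀ T : List (α × K), T.length = ∑ κ, (T.filter (fun p => p.2 = κ)).length := by
    intro T
    induction T with
    | nil => simp
    | cons p T ih =>
      have h : ∀ κ, ((p :: T).filter (fun p => p.2 = κ)).length =
          (T.filter (fun p => p.2 = κ)).length + if p.2 = κ then 1 else 0 := by
        intro κ
        by_cases h : p.2 = κ <;> simp [h]
      simp [h, Finset.sum_add_distrib, ← ih]
  by_contra! h
  have h1 : ∑ κ, (T.filter (fun p => p.2 = κ)).length ≤ ∑ _κ : K, n :=
    Finset.sum_le_sum fun κ _ => (h κ).le
  simp only [← key, Finset.sum_const, Finset.card_univ, smul_eq_mul] at h1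
  omega

/-- Ramsey's theorem for `k`-uniform hypergraphs, phrased with sublists. -/
theorem List.exists_ramsey (K : Type*) [Finite K] (k n : ℕ) :
    ∃ N : ℕ, ∀ {α : Type} (c : List α → K) (S : List α), N ≤ S.length →
      ∃ T, T.Sublist S ∧ T.length = n ∧
        ∃ κ, ∀ l : List α, l.Sublist T → l.length = k → c l = κ := by
  classical
  have := Fintype.ofFinite K
  induction k generalizing n with
  | zero =>
    refine ⟨n, fun c S hS => ⟨S.take n, S.take_sublist n, by simpa using hS, c [], ?_⟩⟩
    intro l _ hl
    rw [List.length_eq_zero_iff.1 hl]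
  | succ k ih =>
    have ends : ∀ m : ℕ, ∃ N : ℕ, ∀ {α : Type} (c : List α → K) (S : List α), N ≤ S.length →
        ∃ T : List (α × K), (T.map Prod.fst).Sublist S ∧ T.length = m ∧
          ∀ p l, (p :: l).Sublist T → l.length = k → c (p.1 :: l.map Prod.fst) = p.2 := by
      intro m
      induction m with
      | zero => exact ⟨0, fun c S _ => ⟨[], by simp, rfl, by simp⟩⟩
      | succ m ihm =>
        obtain ⟨M, hM⟩ := ihm
        obtain ⟨N, hN⟩ := ih M
        refine ⟨N + 1, fun c S hS => ?_⟩
        cases S with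
        | nil => simp at hS
        | cons x S =>
          obtain ⟨S', hS', hlen, κ, hκ⟩ := hN (fun l => c (x :: l)) S (by simpa using hS)
          obtain ⟨T, hT, hTlen, hTc⟩ := hM c S' hlen.ge
          refine ⟨(x, κ) :: T, ?_, by simp [hTlen], ?_⟩
          · simpa using hT.trans hS'
          · intro p l hl hlk
            rw [List.cons_sublist_cons'] at hl
            rcases hl with hl | ⟨rfl, hl⟩
            · exact hTc p l hl hlk
            · exact hκ _ ((hl.map _).trans hT) (by simpa using hlk)
    obtain ⟨N, hN⟩ := ends (Fintype.card K * n + 1)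
    refine ⟨N, fun c S hS => ?_⟩
    obtain ⟨T, hT, hlen, hc⟩ := hN c S hS
    obtain ⟨κ, hκ⟩ := T.exists_le_length_filter_snd n (by omega)
    set F := T.filter (fun p => p.2 = κ)
    have hFT : F.Sublist T := List.filter_sublist
    refine ⟨(F.take n).map Prod.fst, (((F.take_sublist n).trans hFT).map _).trans hT,
      by simpa using hκ, κ, fun l hl hlk => ?_⟩
    obtain ⟨l', hl', rfl⟩ := List.sublist_map_iff.1 hl
    replace hl' := hl'.trans (F.take_sublist n)
    cases l' with
    | nil => simp at hlk
    | cons p l' =>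
      have hp : p ∈ F := hl'.subset (by simp)
      rw [List.map_cons, hc p l' (hl'.trans hFT) (by simpa using hlk)]
      simpa using (List.mem_filter.1 hp).2

namespace SimpleGraph

variable {V : Type*} {G : SimpleGraph V}

/-- A sequence of vertices that induces a path gives an induced copy of `pathGraph ℓ`. -/
theorem containsInduced_pathGraph_of_seq {ℓ : ℕ} (w : Fin ℓ → V) (hw : Function.Injective w)
    (hadj : ∀ i j, G.Adj (w i) (w j) ↔ (pathGraph ℓ).Adj i j) :
    ContainsInduced G (pathGraph ℓ) :=
  ⟨Set.range w, ⟨RelIso.symm ⟨Equiv.ofInjective w hw, by simp [hadj]⟩⟩⟩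

theorem Walk.sub_le_dist_getVert {a b : V} (p : G.Walk a b) (hp : p.length = G.dist a b)
    {i j : ℕ} (hj : j ≤ p.length) : j - i ≤ G.dist (p.getVert i) (p.getVert j) := by
  have hr : G.Reachable (p.getVert i) (p.getVert j) :=
    ((p.take i).reachable.symm).trans (p.take j).reachable
  obtain ⟨q, hq⟩ := hr.exists_walk_length_eq_dist
  have h := dist_le (((p.take i).append q).append (p.drop j))
  simp only [Walk.length_append, Walk.take_length, Walk.drop_length] at h
  omega

/-- In an induced subgraph, vertices at large distance yield a long induced path. -/
theorem containsInduced_pathGraph_of_le_dist {ℓ : ℕ} {X : Set V} {a b : X}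
    (hr : (G.induce X).Reachable a b) (hd : ℓ ≤ (G.induce X).dist a b + 1) :
    ContainsInduced G (pathGraph ℓ) := by
  obtain ⟨p, hp⟩ := hr.exists_walk_length_eq_dist
  have hsub := fun i j hj => p.sub_le_dist_getVert hp (i := i) (j := j) hj
  refine containsInduced_pathGraph_of_seq (fun i : Fin ℓ => (p.getVert i : V)) ?_ ?_
  · intro i j hij
    have hij : p.getVert i = p.getVert j := Subtype.ext hij
    have h1 := hsub i j (by omega)
    have h2 := hsub j i (by omega)
    rw [hij, dist_self] at h1
    rw [hij, dist_self] at h2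
    omega
  · intro i j
    rw [pathGraph_adj]
    constructor
    · intro h
      have h : (G.induce X).Adj (p.getVert i) (p.getVert j) := h
      have h1 := hsub i j (by omega)
      have h2 := hsub j i (by omega)
      rw [dist_eq_one_iff_adj.2 h] at h1
      rw [dist_eq_one_iff_adj.2 h.symm] at h2
      have hne : (i : ℕ) ≠ j := fun e => h.ne (by rw [e])
      omega
    · rintro (h | h)
      · rw [← h]
        exact p.adj_getVert_succ (i := i) (by omega)
      · rw [← h]
        exact (p.adj_getVert_succ (i := j) (by omega)).symm

theorem reachable_induce_of_seq {X : Set V} {f : ℕ → V} {i j : ℕ} (hij : i ≤ j)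
    (hX : ∀ n, i ≤ n → n ≤ j → f n ∈ X)
    (hf : ∀ n, i ≤ n → n < j → f n = f (n + 1) ∨ G.Adj (f n) (f (n + 1))) :
    (G.induce X).Reachable ⟨f i, hX i le_rfl hij⟩ ⟨f j, hX j hij le_rfl⟩ := by
  induction j, hij using Nat.le_induction with
  | base => exact Reachable.rfl
  | succ j hij ih =>
    refine (ih (fun n h h' => hX n h (by omega)) (fun n h h' => hf n h (by omega))).trans ?_
    rcases hf j hij (by omega) with h | h
    · have : (⟨f j, hX j hij (by omega)⟩ : X) = ⟨f (j + 1), hX (j + 1) (by omega) le_rfl⟩ :=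
        Subtype.ext h
      rw [this]
    · exact Adj.reachable (G := G.induce X) h

theorem Walk.le_add_length_of_lipschitz {L : V → ℕ} (hL : ∀ x y, G.Adj x y → L y ≤ L x + 1)
    {a b : V} (p : G.Walk a b) : L b ≤ L a + p.length := by
  induction p with
  | nil => simp
  | cons h p ih =>
    have := hL _ _ h
    rw [Walk.length_cons]
    omega

/-- Without induced paths on `ℓ` vertices, connections inside a set can be made short. -/
theorem exists_short_seq {ℓ : ℕ} (hG : ¬ ContainsInduced G (pathGraph ℓ)) {X : Set V} {a b : X}
    (hr : (G.induce X).Reachable a b) :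
    ∃ w : ℕ → V, w 0 = a ∧ w ℓ = b ∧ (∀ m, w m ∈ X) ∧
      ∀ m, w m = w (m + 1) ∨ G.Adj (w m) (w (m + 1)) := by
  obtain ⟨p, hp⟩ := hr.exists_walk_length_eq_dist
  have hlt : p.length < ℓ := by
    by_contra! h
    exact hG (containsInduced_pathGraph_of_le_dist hr (by omega))
  refine ⟨fun m => p.getVert m, by simp, by simp [p.getVert_of_length_le hlt.le],
    fun m => (p.getVert m).2, fun m => ?_⟩
  rcases lt_or_ge m p.length with h | h
  · exact .inr (p.adj_getVert_succ h)
  · left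
    simp only [p.getVert_of_length_le h, p.getVert_of_length_le (h.trans m.le_succ)]

/-- A sequence of connected layers in which only consecutive layers may be adjacent contains a
long induced path. -/
theorem containsInduced_pathGraph_of_layers {ℓ N : ℕ} (W : ℕ → ℕ → V)
    (hW : ∀ i ≤ N, ∀ m, W i m = W i (m + 1) ∨ G.Adj (W i m) (W i (m + 1)))
    (hglue : ∀ i < N, W i ℓ = W (i + 1) 0)
    (hfirst : ∀ i ≤ N, ∀ m, W i m = W 0 0 → i = 0)
    (hlast : ∀ i ≤ N, ∀ m, W i m = W N ℓ → i = N)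
    (hnadj : ∀ i j m m', i + 2 ≤ j → j ≤ N → m ≤ ℓ → m' ≤ ℓ → ¬ G.Adj (W i m) (W j m'))
    (hN : ℓ ≤ N + 1) : ContainsInduced G (pathGraph ℓ) := by
  let X : Set V := {x | ∃ i ≤ N, ∃ m ≤ ℓ, x = W i m}
  have hmem : ∀ i ≤ N, ∀ m ≤ ℓ, W i m ∈ X := fun i hi m hm => ⟨i, hi, m, hm, rfl⟩
  have hlayer : ∀ i (hi : i ≤ N), (G.induce X).Reachable ⟨W i 0, hmem i hi 0 (Nat.zero_le _)⟩
      ⟨W i ℓ, hmem i hi ℓ le_rfl⟩ := fun i hi =>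
    reachable_induce_of_seq (f := W i) (Nat.zero_le ℓ) (fun n _ h => hmem i hi n h)
      (fun n _ _ => hW i hi n)
  have hreach : ∀ i (hi : i ≤ N), (G.induce X).Reachable
      ⟨W 0 0, hmem 0 (Nat.zero_le _) 0 (Nat.zero_le _)⟩ ⟨W i ℓ, hmem i hi ℓ le_rfl⟩ := by
    intro i
    induction i with
    | zero => exact hlayer 0
    | succ i ih =>
      intro hi
      refine (ih (by omega)).trans ?_
      convert hlayer (i + 1) hi using 2
      exact hglue i (by omega)
  choose L hLN m hm hLm using fun x : X => x.2
  refine containsInduced_pathGraph_of_le_dist (hreach N le_rfl) ?_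
  obtain ⟨p, hp⟩ := (hreach N le_rfl).exists_walk_length_eq_dist
  have hlip : ∀ x y, (G.induce X).Adj x y → L y ≤ L x + 1 := by
    intro x y hxy
    by_contra! h
    have hxy : G.Adj x y := hxy
    rw [hLm x, hLm y] at hxy
    exact hnadj _ _ _ _ (by omega) (hLN y) (hm x) (hm y) hxy
  have h := p.le_add_length_of_lipschitz hlip
  rw [hfirst _ (hLN _) _ (hLm ⟨W 0 0, _⟩).symm, hlast _ (hLN _) _ (hLm ⟨W N ℓ, _⟩).symm] at h
  omega

end SimpleGraph


/-- Galvin–Rival–Sands: for all `r`, `s`, `ℓ` there is a number `c = c(r,s,ℓ)` such that every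
`K_{r,s}`-subgraph-free graph containing a path of length `c` contains an induced path on
`ℓ` vertices. -/
theorem galvin_rival_sands (r s ℓ : ℕ) :
    ∃ c : ℕ, ∀ (V : Type) (G : SimpleGraph V),
      ¬ ContainsSub G (completeBipartiteGraph (Fin r) (Fin s)) →
      (∃ (u v : V) (p : G.Walk u v), p.IsPath ∧ p.length = c) →
      ContainsInduced G (SimpleGraph.pathGraph ℓ) := by
  classical
  set n := 2 * (r + s) + ℓ + 3
  obtain ⟨c, hc⟩ := List.exists_ramsey (Fin (ℓ + 1) → Fin (ℓ + 1) → Prop) 4 n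
  refine ⟨c, fun V G hK ⟨u, v, p, hp, hlen⟩ => ?_⟩
  by_contra hG
  have hinj : ∀ i j, i ≤ c → j ≤ c → p.getVert i = p.getVert j → i = j := fun i j hi hj h =>
    hp.getVert_injOn (by simpa [hlen] using hi) (by simpa [hlen] using hj) h
  have hconn : ∀ i j, ∃ w : ℕ → V, i ≤ j → j ≤ c →
      w 0 = p.getVert i ∧ w ℓ = p.getVert j ∧ (∀ m, w m ∈ p.getVert '' Set.Icc i j) ∧
        ∀ m, w m = w (m + 1) ∨ G.Adj (w m) (w (m + 1)) := by
    intro i j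
    by_cases h : i ≤ j ∧ j ≤ c
    · obtain ⟨w, hw⟩ := SimpleGraph.exists_short_seq hG (SimpleGraph.reachable_induce_of_seq (G := G) (f := p.getVert)
        (X := p.getVert '' Set.Icc i j) h.1 (fun n h1 h2 => ⟨n, ⟨h1, h2⟩, rfl⟩)
        (fun n h1 h2 => .inr (p.adj_getVert_succ (by omega))))
      exact ⟨w, fun _ _ => hw⟩
    · exact ⟨fun _ => u, fun h1 h2 => (h ⟨h1, h2⟩).elim⟩
  choose W hW using hconn
  obtain ⟨T, hTS, hTn, κ, hκ⟩ := hc (fun l m m' => G.Adj (W (l.getD 0 0) (l.getD 1 0) m)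
    (W (l.getD 2 0) (l.getD 3 0) m')) (List.range (c + 1)) (by simp)
  set a : ℕ → ℕ := fun i => T.getD i 0 with ha
  have ha_lt : ∀ i j, i < j → j < n → a i < a j := by
    intro i j hij hj
    have h := List.pairwise_iff_getElem.1 (List.pairwise_lt_range.sublist hTS) i j
      (by omega) (by omega) hij
    simpa [ha, List.getD_eq_getElem, hTn, hj, hij.trans hj] using h
  have ha_le : ∀ i, i < n → a i ≤ c := by
    intro i hi
    have h : T[i]'(by omega) ∈ List.range (c + 1) := hTS.subset (List.getElem_mem _)
    rw [List.mem_range] at h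
    simp only [ha, List.getD_eq_getElem _ _ (hTn.symm ▸ hi)]
    omega
  have hadj : ∀ i j k l, i < j → j < k → k < l → l < n → ∀ m m' : Fin (ℓ + 1),
      (G.Adj (W (a i) (a j) m) (W (a k) (a l) m') ↔ κ m m') := by
    intro i j k l hij hjk hkl hl m m'
    have h := List.map_getElem_sublist (l := T)
      (is := [⟨i, by omega⟩, ⟨j, by omega⟩, ⟨k, by omega⟩, ⟨l, by omega⟩])
      (by simp; omega)
    have h := congrFun (congrFun (hκ _ h (by simp)) m) m'
    simp only [List.map_cons, List.getD_cons_zero, List.getD_cons_succ] at h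
    simp only [ha]
    rw [List.getD_eq_getElem _ _ (by omega), List.getD_eq_getElem _ _ (by omega),
      List.getD_eq_getElem _ _ (by omega), List.getD_eq_getElem _ _ (by omega)]
    exact iff_of_eq h
  have hWa : ∀ i j, i < j → j < n → _ := fun i j hij hj =>
    hW (a i) (a j) (ha_lt i j hij hj).le (ha_le j hj)
  have hsep : ∀ i j k l m m', i < j → j < k → k < l → l < n →
      W (a i) (a j) m ≠ W (a k) (a l) m' := by
    intro i j k l m m' hij hjk hkl hl h
    obtain ⟨x, hx, hx'⟩ := (hWa i j hij (by omega)).2.2.1 m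
    obtain ⟨y, hy, hy'⟩ := (hWa k l hkl hl).2.2.1 m'
    have := ha_le l hl
    have := ha_lt j k hjk (by omega)
    have := ha_lt k l hkl (by omega)
    have := hinj x y (by grind) (by grind) (by rw [hx', hy', h])
    grind
  have hκ_false : ∀ m m', ¬ κ m m' := by
    intro m m' hm
    refine hK ⟨⟨Sum.elim (fun k : Fin r => W (a (2 * k)) (a (2 * k + 1)) m)
      (fun k : Fin s => W (a (2 * (r + k))) (a (2 * (r + k) + 1)) m'), ?_⟩, ?_⟩
    · have h : ∀ (i : Fin r) (j : Fin s), G.Adj (W (a (2 * i)) (a (2 * i + 1)) m)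
          (W (a (2 * (r + j))) (a (2 * (r + j) + 1)) m') := fun i j =>
        (hadj _ _ _ _ (by omega) (by omega) (by omega) (by omega) m m').2 hm
      rintro (i | i) (j | j) hij
      · simp at hij
      · exact h i j
      · exact (h j i).symm
      · simp at hij
    · have h : ∀ i j m m', i < j → j < r + s →
          W (a (2 * i)) (a (2 * i + 1)) m ≠ W (a (2 * j)) (a (2 * j + 1)) m' :=
        fun i j m m' hij hj => hsep _ _ _ _ m m' (by omega) (by omega) (by omega) (by omega)
      have h' : ∀ i j m m', i < r + s → j < r + s →
          W (a (2 * i)) (a (2 * i + 1)) m = W (a (2 * j)) (a (2 * j + 1)) m' → i = j := by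
        intro i j m m' hi hj hij
        rcases lt_trichotomy i j with hlt | heq | hlt
        · exact (h i j m m' hlt hj hij).elim
        · exact heq
        · exact (h j i m' m hlt hi hij.symm).elim
      rintro (i | i) (j | j) hij
      · exact congrArg _ (Fin.ext (h' i j m m (by omega) (by omega) hij))
      · have := h' i (r + j) m m' (by omega) (by omega) hij
        omega
      · have := h' (r + i) j m' m (by omega) (by omega) hij
        omega
      · have := h' (r + i) (r + j) m' m' (by omega) (by omega) hij
        exact congrArg _ (Fin.ext (by omega))
  have hmem : ∀ i m k, i + 1 < n → k < n → W (a i) (a (i + 1)) m = p.getVert (a k) →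
      a i ≤ a k ∧ a k ≤ a (i + 1) := by
    intro i m k hi hk h
    obtain ⟨x, hx, hx'⟩ := (hWa i (i + 1) (by omega) hi).2.2.1 m
    have := ha_le (i + 1) hi
    have := hinj x (a k) (by grind) (ha_le k hk) (hx'.trans h)
    grind
  refine hG (SimpleGraph.containsInduced_pathGraph_of_layers (ℓ := ℓ) (N := ℓ + 1)
    (fun i => W (a i) (a (i + 1))) (fun i hi => (hWa i (i + 1) (by omega) (by omega)).2.2.2)
    (fun i hi => ?_) (fun i hi m h => ?_) (fun i hi m h => ?_) (fun i j m m' hij hj hm hm' h => ?_)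
    (by omega))
  · rw [(hWa i (i + 1) (by omega) (by omega)).2.1,
      (hWa (i + 1) (i + 1 + 1) (by omega) (by omega)).1]
  · rw [(hWa 0 (0 + 1) (by omega) (by omega)).1] at h
    by_contra hi0
    have := (hmem i m 0 (by omega) (by omega) h).1
    have := ha_lt 0 i (by omega) (by omega)
    omega
  · rw [(hWa (ℓ + 1) (ℓ + 1 + 1) (by omega) (by omega)).2.1] at h
    by_contra hiN
    have := (hmem i m (ℓ + 1 + 1) (by omega) (by omega) h).2
    have := ha_lt (i + 1) (ℓ + 1 + 1) (by omega) (by omega)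
    omega
  · exact hκ_false _ _ ((hadj i (i + 1) j (j + 1) (by omega) (by omega) (by omega) (by omega)
      ⟨m, by omega⟩ ⟨m', by omega⟩).1 h)
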